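/- arXiv:2404.07934 — 7 statements merged into one kernel-verified Lean document; each statement's English description precedes it below -/
import Mathlib

section
/- (Theorem 1, h^IP_Ω is a lower bound.) Let s be a state of a SAS⁺ planning task with operators O and goal condition G, let Ω be an observation sequence, and let C be an operator-counting constraint set for the goal-recognition task at s. Then for every s-plan π for G complying with Ω, the satisfying IP heuristic value with constraints C and C_Ω (with υ = 0) is at most cost(π). In particular, the satisfying IP heuristic value is a lower bound on the minimum cost of an s-plan for G complying with Ω. -/
open scoped BigOperators ENNReal

/-- An operator `o` is applicable in state `s` iff its precondition is contained in `s`. -/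
def Applicable {Op V D : Type} (preO : Op → V → Option D) (o : Op) (s : V → D) : Prop :=
  ∀ v d, preO o v = some d → s v = d

/-- The state resulting from applying operator `o` in state `s`. -/
def ApplyOp {Op V D : Type} (postO : Op → V → Option D) (o : Op) (s : V → D) : V → D :=
  fun v => (postO o v).getD (s v)

/-- A sequence of operators is sequentially applicable from a state. -/
def SeqApplicable {Op V D : Type} (preO postO : Op → V → Option D) :
    (V → D) → List Op → Prop
  | _, [] => True
  | s, o :: rest => Applicable preO o s ∧ SeqApplicable preO postO (ApplyOp postO o s) rest

/-- The state reached after executing the sequence `π` from `s`. -/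
def ExecList {Op V D : Type} (postO : Op → V → Option D) (s : V → D) (π : List Op) : V → D :=
  π.foldl (fun st o => ApplyOp postO o st) s

/-- A state satisfies a partial assignment (goal condition). -/
def SatisfiesGoal {V D : Type} (s : V → D) (G : V → Option D) : Prop :=
  ∀ v d, G v = some d → s v = d

/-- `π` is an `s`-plan for goal condition `G`. -/
def IsPlan {Op V D : Type} (preO postO : Op → V → Option D) (s : V → D)
    (π : List Op) (G : V → Option D) : Prop :=
  SeqApplicable preO postO s π ∧ SatisfiesGoal (ExecList postO s π) G

/-- The cost of a plan: sum of the costs of its operators. -/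
def PlanCost {Op : Type} (cost : Op → ℕ) (π : List Op) : ℕ := (π.map cost).sum

/-- The observation-counting constraints `C_Ω` with unreliability rating `υ`. -/
def ObsConstraints {Op : Type} [Fintype Op] [DecidableEq Op]
    (Ω : List Op) (υ : ℝ) (Y YΩ : Op → ℕ) : Prop :=
  (∀ o, YΩ o ≤ Ω.count o) ∧ (∀ o, YΩ o ≤ Y o) ∧
  (Ω.length - ⌊(Ω.length : ℝ) * υ⌋₊ ≤ ∑ o, YΩ o)

/-- The satisfying IP heuristic value: infimum of the objective over all nonnegative
integer assignments that are feasible (`∞` if none exists). -/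
noncomputable def IPValue {Op : Type} [Fintype Op] (cost : Op → ℕ)
    (Feas : (Op → ℕ) → Prop) : ℝ≥0∞ :=
  sInf {c : ℝ≥0∞ | ∃ Y : Op → ℕ, Feas Y ∧ c = ((∑ o, cost o * Y o : ℕ) : ℝ≥0∞)}

/-- `Ω` is obtained from `Ω'` by inserting, at arbitrary positions, entries that are
each an operator not occurring in `π`. -/
def NoisyFrom {Op : Type} [DecidableEq Op] (Ω Ω' π : List Op) : Prop :=
  Ω'.Sublist Ω ∧ ∀ o, Ω'.count o < Ω.count o → o ∉ π

/-- Theorem 1, h^IP_Ω is a lower bound: if C is an operator-counting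
constraint set for the goal-recognition task at s, then for every s-plan π for G
complying with Ω the satisfying IP heuristic value with constraints C and C_Ω
(υ = 0) is at most cost(π); in particular it is a lower bound on the minimum cost
of an s-plan for G complying with Ω. -/
theorem ipValue_lower_bound {Op V D : Type} [Fintype Op] [DecidableEq Op]
    (preO postO : Op → V → Option D) (s : V → D) (G : V → Option D)
    (Ω : List Op) (cost : Op → ℕ) (C : (Op → ℕ) → Prop)
    (hC : ∀ π : List Op, IsPlan preO postO s π G → Ω.Sublist π →
      C (fun o => π.count o)) :
    (∀ π : List Op, IsPlan preO postO s π G → Ω.Sublist π →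
      IPValue cost (fun Y => C Y ∧ ∃ YΩ : Op → ℕ, ObsConstraints Ω 0 Y YΩ) ≤
        ((PlanCost cost π : ℕ) : ℝ≥0∞)) ∧
    IPValue cost (fun Y => C Y ∧ ∃ YΩ : Op → ℕ, ObsConstraints Ω 0 Y YΩ) ≤
      sInf {c : ℝ≥0∞ | ∃ π : List Op, IsPlan preO postO s π G ∧ Ω.Sublist π ∧
        c = ((PlanCost cost π : ℕ) : ℝ≥0∞)} := by
  have key : ∀ π : List Op, IsPlan preO postO s π G → Ω.Sublist π →
      IPValue cost (fun Y => C Y ∧ ∃ YΩ : Op → ℕ, ObsConstraints Ω 0 Y YΩ) ≤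
        ((PlanCost cost π : ℕ) : ℝ≥0∞) := by
    intro π hπ hsub
    have hlen : ∑ o, Ω.count o = Ω.length := by
      have h := Multiset.sum_count_eq_card (s := Finset.univ) (m := (Ω : Multiset Op))
        (fun a _ => Finset.mem_univ a)
      simpa using h
    refine sInf_le ⟨fun o => π.count o, ⟨hC π hπ hsub, fun o => Ω.count o,
      fun o => le_rfl, fun o => hsub.count_le o, ?_⟩, ?_⟩
    · rw [hlen]
      exact Nat.sub_le _ _
    · congr 1
      unfold PlanCost
      rw [Finset.sum_list_map_count]
      simp only [smul_eq_mul]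
      rw [Finset.sum_subset (Finset.subset_univ π.toFinset)]
      · exact Finset.sum_congr rfl fun o _ => mul_comm _ _
      · intro o _ ho
        rw [List.count_eq_zero_of_not_mem (by simpa using ho), zero_mul]
  refine ⟨key, le_sInf ?_⟩
  rintro c ⟨π, hπ, hsub, rfl⟩
  exact key π hπ hsub
end

section
/- (Theorem 1, inequality chain.) Let s be a state of a SAS⁺ planning task with operators O and goal condition G, let Ω be an observation sequence, and let C be an operator-counting constraint set for the goal-recognition task at s. Let h^LP_Ω(s) and h^IP_Ω(s) be the satisfying LP and IP heuristic values with constraints C and C_Ω (υ = 0), and let h*_Ω(s) be the minimum cost of an s-plan for G complying with Ω (∞ if no such plan exists). Then h^LP_Ω(s) ≤ h^IP_Ω(s) ≤ h*_Ω(s). -/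
open scoped BigOperators ENNReal

/-- The observation-counting constraints over nonnegative real variables. -/
def ObsConstraintsReal {Op : Type} [Fintype Op] [DecidableEq Op]
    (Ω : List Op) (υ : ℝ) (Y YΩ : Op → ℝ) : Prop :=
  (∀ o, 0 ≤ YΩ o) ∧ (∀ o, YΩ o ≤ Ω.count o) ∧ (∀ o, YΩ o ≤ Y o) ∧
  ((Ω.length : ℝ) - ⌊(Ω.length : ℝ) * υ⌋₊ ≤ ∑ o, YΩ o)

/-- The satisfying LP heuristic value: infimum of the objective over all nonnegative
real assignments that are feasible (infinity if none exists). -/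
noncomputable def LPValue {Op : Type} [Fintype Op] (cost : Op → ℕ)
    (Feas : (Op → ℝ) → Prop) : ℝ≥0∞ :=
  sInf {c : ℝ≥0∞ | ∃ Y : Op → ℝ, (∀ o, 0 ≤ Y o) ∧ Feas Y ∧
    c = ENNReal.ofReal (∑ o, (cost o : ℝ) * Y o)}

/-- Theorem 1, inequality chain: h^LP_Ω(s) ≤ h^IP_Ω(s) ≤ h*_Ω(s),
where C is an operator-counting constraint set for the goal-recognition task at s,
the heuristics use constraints C and C_Ω with υ = 0, and h*_Ω(s) is the minimum
cost of an s-plan for G complying with Ω (∞ if none exists). -/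
theorem lp_le_ip_le_optimal {Op V D : Type} [Fintype Op] [DecidableEq Op]
    (preO postO : Op → V → Option D) (s : V → D) (G : V → Option D)
    (Ω : List Op) (cost : Op → ℕ) (C : (Op → ℝ) → Prop)
    (hC : ∀ π : List Op, IsPlan preO postO s π G → Ω.Sublist π →
      C (fun o => (π.count o : ℝ))) :
    LPValue cost (fun Y => C Y ∧ ∃ YΩ : Op → ℝ, ObsConstraintsReal Ω 0 Y YΩ) ≤
      IPValue cost (fun Y : Op → ℕ => C (fun o => (Y o : ℝ)) ∧
        ∃ YΩ : Op → ℕ, ObsConstraints Ω 0 Y YΩ) ∧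
    IPValue cost (fun Y : Op → ℕ => C (fun o => (Y o : ℝ)) ∧
        ∃ YΩ : Op → ℕ, ObsConstraints Ω 0 Y YΩ) ≤
      sInf {c : ℝ≥0∞ | ∃ π : List Op, IsPlan preO postO s π G ∧ Ω.Sublist π ∧
        c = ((PlanCost cost π : ℕ) : ℝ≥0∞)} := by
  constructor
  · unfold LPValue IPValue
    apply le_sInf
    rintro c ⟨Y, ⟨hCY, YΩ, h1, h2, h3⟩, rfl⟩
    apply sInf_le
    refine ⟨fun o => (Y o : ℝ), fun o => Nat.cast_nonneg _,
      ⟨hCY, fun o => (YΩ o : ℝ), fun o => Nat.cast_nonneg _, fun o => ?_, fun o => ?_, ?_⟩, ?_⟩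
    · exact Nat.cast_le.mpr (h1 o)
    · exact Nat.cast_le.mpr (h2 o)
    · simp only [mul_zero, Nat.floor_zero, Nat.sub_zero] at h3
      simp only [mul_zero, Nat.floor_zero, Nat.cast_zero, sub_zero]
      exact_mod_cast h3
    · rw [← ENNReal.ofReal_natCast]
      push_cast
      rfl
  · unfold IPValue
    apply le_sInf
    rintro c ⟨π, hπ, hs, rfl⟩
    apply sInf_le
    refine ⟨fun o => π.count o, ⟨hC π hπ hs, fun o => Ω.count o, fun o => le_rfl,
      fun o => hs.count_le o, ?_⟩, ?_⟩
    · simp only [mul_zero, Nat.floor_zero, Nat.sub_zero]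
      have h := Multiset.sum_count_eq_card (s := Finset.univ) (m := (Ω : Multiset Op))
        (fun a _ => Finset.mem_univ a)
      simp only [Multiset.coe_count, Multiset.coe_card] at h
      exact h.ge
    · congr 1
      unfold PlanCost
      rw [Finset.sum_list_map_count]
      simp only [smul_eq_mul]
      rw [Finset.sum_subset (Finset.subset_univ π.toFinset)]
      · exact Finset.sum_congr rfl fun o _ => mul_comm _ _
      · intro o _ ho
        rw [List.mem_toFinset] at ho
        simp [List.count_eq_zero_of_not_mem ho]
end

section
/- (Theorem 2, h^IP_Ω is a lower bound in the presence of noisy observations.) Let υ ∈ [0,1), let Ω be obtained from a sequence Ω' by inserting at most ⌊|Ω|·υ⌋ entries, each being an operator not occurring in the plan π, and let π be an s-plan for goal condition G complying with Ω'. Then the assignment Y_o := occ_π(o) for all o ∈ O, and Y^Ω_o := occ_Ω(o) if o occurs in π and Y^Ω_o := 0 otherwise, satisfies all observation-counting constraints C_Ω with unreliability υ. Consequently, if C is an operator-counting constraint set for the goal-recognition task at s (so that this assignment extends to a solution of C), the satisfying IP heuristic value with constraints C and C_Ω is at most cost(π), i.e., it is a lower bound on the cost of an optimal plan complying with the non-noisy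 observations. -/
open scoped BigOperators ENNReal

/-- Theorem 2, h^IP_Ω is a lower bound with noisy observations:
if Ω is obtained from Ω' by inserting at most floor(|Ω| * υ) entries, each an operator
not occurring in π, and π is an s-plan for G complying with Ω', then the assignment
Y_o := occ_π(o), Y^Ω_o := occ_Ω(o) if o occurs in π and 0 otherwise, satisfies the
observation-counting constraints C_Ω with unreliability υ; consequently, for every
operator-counting constraint set C for the goal-recognition task at s, the satisfying
IP heuristic value with constraints C and C_Ω is at most cost(π). -/
theorem ipValue_lower_bound_noisy {Op V D : Type} [Fintype Op] [DecidableEq Op]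
    (preO postO : Op → V → Option D) (s : V → D) (G : V → Option D)
    (π Ω Ω' : List Op) (cost : Op → ℕ) (υ : ℝ)
    (hυ0 : 0 ≤ υ) (hυ1 : υ < 1)
    (hnoisy : NoisyFrom Ω Ω' π)
    (hbound : Ω.length ≤ Ω'.length + ⌊(Ω.length : ℝ) * υ⌋₊)
    (hplan : IsPlan preO postO s π G) (hcomply : Ω'.Sublist π) :
    ObsConstraints Ω υ (fun o => π.count o)
      (fun o => if o ∈ π then Ω.count o else 0) ∧
    ∀ C : (Op → ℕ) → Prop,
      (∀ π' : List Op, IsPlan preO postO s π' G → Ω'.Sublist π' →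
        C (fun o => π'.count o)) →
      IPValue cost (fun Y => C Y ∧ ∃ YΩ : Op → ℕ, ObsConstraints Ω υ Y YΩ) ≤
        ((PlanCost cost π : ℕ) : ℝ≥0∞) := by
  have hcount : ∀ (l : List Op) (f : Op → ℕ), ∑ o, f o * l.count o = (l.map f).sum := by
    intro l f
    induction l with
    | nil => simp
    | cons a t ih =>
      simp only [List.count_cons, mul_add, Finset.sum_add_distrib, ih, List.map_cons,
        List.sum_cons]
      simp [add_comm]
  have hobs : ObsConstraints Ω υ (fun o => π.count o)
      (fun o => if o ∈ π then Ω.count o else 0) := by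
    refine ⟨fun o => ?_, fun o => ?_, ?_⟩
    · dsimp only
      split_ifs <;> simp
    · dsimp only
      split_ifs with h
      · have h1 : Ω.count o ≤ Ω'.count o := by
          by_contra hlt
          exact hnoisy.2 o (not_le.mp hlt) h
        exact h1.trans (hcomply.count_le o)
      · simp
    · have h2 : Ω'.length = ∑ o, Ω'.count o := by
        have := hcount Ω' (fun _ => 1)
        simpa using this.symm
      have h3 : ∑ o, Ω'.count o ≤ ∑ o, (if o ∈ π then Ω.count o else 0) := by
        refine Finset.sum_le_sum fun o _ => ?_
        split_ifs with h
        · exact hnoisy.1.count_le o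
        · have : o ∉ Ω' := fun hm => h (hcomply.subset hm)
          simp [List.count_eq_zero_of_not_mem this]
      show Ω.length - ⌊(Ω.length : ℝ) * υ⌋₊ ≤ ∑ o, (if o ∈ π then Ω.count o else 0)
      omega
  refine ⟨hobs, fun C hC => sInf_le ⟨fun o => π.count o, ⟨hC π hplan hcomply, _, hobs⟩, ?_⟩⟩
  rw [hcount π cost, PlanCost]
end

section
/- Let π be an s-plan for goal condition G of a SAS⁺ planning task that complies with the observation sequence Ω, let ω be an entry of Ω, and let L be a disjunctive action landmark for state s and goal condition pre(ω), i.e., a set of operators such that every s-plan for the goal condition pre(ω) contains at least one operator of L. Then π contains at least one operator of L; equivalently, Σ_{o∈L} occ_π(o) ≥ 1. -/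
open scoped BigOperators ENNReal

/-- A sequentially applicable sequence containing `ω` has a prefix reaching `pre(ω)`. -/
theorem exists_prefix_plan {Op V D : Type} (preO postO : Op → V → Option D) (ω : Op) :
    ∀ (π : List Op) (s : V → D), SeqApplicable preO postO s π → ω ∈ π →
      ∃ π' : List Op, IsPlan preO postO s π' (preO ω) ∧ π' ⊆ π := by
  intro π
  induction π with
  | nil => intro s _ h; simp at h
  | cons a t ih =>
    intro s hs h
    obtain ⟨ha, ht⟩ := hs
    rcases List.mem_cons.1 h with rfl | h
    · exact ⟨[], ⟨trivial, ha⟩, by simp⟩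
    · obtain ⟨p, ⟨h1, h2⟩, h3⟩ := ih _ ht h
      exact ⟨a :: p, ⟨⟨ha, h1⟩, h2⟩, List.cons_subset_cons a h3⟩

/-- if the s-plan π for G complies with Ω, ω is an entry of Ω, and L is a
disjunctive action landmark for state s and goal condition pre(ω), then π contains at
least one operator of L; equivalently Σ_{o ∈ L} occ_π(o) ≥ 1. -/
theorem complying_plan_hits_observation_landmark {Op V D : Type} [DecidableEq Op]
    (preO postO : Op → V → Option D) (s : V → D) (G : V → Option D)
    (π Ω : List Op)
    (hplan : IsPlan preO postO s π G) (hcomply : Ω.Sublist π)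
    (ω : Op) (hω : ω ∈ Ω) (L : Finset Op)
    (hL : ∀ π' : List Op, IsPlan preO postO s π' (preO ω) → ∃ o ∈ L, o ∈ π') :
    (∃ o ∈ L, o ∈ π) ∧ 1 ≤ ∑ o ∈ L, π.count o := by
  obtain ⟨p, hp, hsub⟩ := exists_prefix_plan preO postO ω π s hplan.1 (hcomply.subset hω)
  obtain ⟨o, hoL, hop⟩ := hL p hp
  refine ⟨⟨o, hoL, hsub hop⟩, ?_⟩
  exact (List.count_pos_iff.2 (hsub hop)).trans_le
    (Finset.single_le_sum (f := fun o => π.count o) (fun _ _ => Nat.zero_le _) hoL)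
end

section
/- (Inequality chain of Theorem 3.) Under the hypotheses of Theorem 3 — υ ∈ [0,1), Ω obtained from Ω' by inserting at most ⌊|Ω|·υ⌋ operators not occurring in the s-plan π, π an s-plan for G complying with Ω', and C an operator-counting constraint set for the goal-recognition task at s — let h^IP_Ω(s) be the satisfying IP heuristic value with constraints C and C_Ω, and let h^{LMC_Ω}(s) be the satisfying IP heuristic value with constraints C, C_Ω and the landmark constraints for goal recognition LMC_Ω. Then h^IP_Ω(s) ≤ h^{LMC_Ω}(s) ≤ cost(π); in particular, h^IP_Ω(s) ≤ h^{LMC_Ω}(s) ≤ h*_Ω(s), the minimum cost of a plan complying with the non-noisy observations. -/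
open scoped BigOperators ENNReal

/-- An assignment (Y, Y^Ω) satisfies all landmark constraints for goal recognition
LMC_Ω: for each entry ω of Ω and each disjunctive action landmark L for state s and
goal condition pre(ω), if Y^Ω_ω > 0 then Σ_{o ∈ L} Y_o ≥ 1. -/
def LMCSat {Op V D : Type} (preO postO : Op → V → Option D) (s : V → D)
    (Ω : List Op) (Y YΩ : Op → ℕ) : Prop :=
  ∀ ω ∈ Ω, ∀ L : Finset Op,
    (∀ π' : List Op, IsPlan preO postO s π' (preO ω) → ∃ o ∈ L, o ∈ π') →
    0 < YΩ ω → 1 ≤ ∑ o ∈ L, Y o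

/-- Splitting a sequentially applicable sequence before an occurrence of an operator gives
a plan for the precondition of this operator. -/
lemma prefix_isPlan {Op V D : Type} (preO postO : Op → V → Option D) (ω : Op) (b : List Op) :
    ∀ (a : List Op) (s : V → D), SeqApplicable preO postO s (a ++ ω :: b) →
      IsPlan preO postO s a (preO ω)
  | [], _, h => ⟨trivial, h.1⟩
  | o :: a, s, h =>
    have ih := prefix_isPlan preO postO ω b a (ApplyOp postO o s) h.2
    ⟨⟨h.1, ih.1⟩, ih.2⟩

lemma planCost_eq {Op : Type} [Fintype Op] [DecidableEq Op] (cost : Op → ℕ) (π : List Op) :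
    ∑ o, cost o * π.count o = PlanCost cost π := by
  induction π with
  | nil => simp [PlanCost]
  | cons a l ih =>
    have h : PlanCost cost (a :: l) = cost a + PlanCost cost l := by simp [PlanCost]
    rw [h, ← ih]
    simp only [List.count_cons, mul_add, Finset.sum_add_distrib]
    rw [add_comm]
    congr 1
    simp

lemma sum_count_length {Op : Type} [Fintype Op] [DecidableEq Op] (l : List Op) :
    ∑ o, l.count o = l.length := by
  have h := planCost_eq (fun _ => 1) l
  simpa [PlanCost] using h

lemma lmc_le_cost {Op V D : Type} [Fintype Op] [DecidableEq Op]
    (preO postO : Op → V → Option D) (s : V → D) (G : V → Option D)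
    (π Ω Ω' : List Op) (cost : Op → ℕ) (υ : ℝ)
    (hsub : Ω'.Sublist Ω)
    (hbound : Ω.length ≤ Ω'.length + ⌊(Ω.length : ℝ) * υ⌋₊)
    (hplan : IsPlan preO postO s π G) (hcomply : Ω'.Sublist π)
    (C : (Op → ℕ) → Prop) (hC : C (fun o => π.count o)) :
    IPValue cost (fun Y => C Y ∧ ∃ YΩ : Op → ℕ,
        ObsConstraints Ω υ Y YΩ ∧ LMCSat preO postO s Ω Y YΩ) ≤
      ((PlanCost cost π : ℕ) : ℝ≥0∞) := by
  apply sInf_le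
  refine ⟨fun o => π.count o, ⟨hC, fun o => Ω'.count o, ⟨fun o => hsub.count_le o,
    fun o => hcomply.count_le o, ?_⟩, ?_⟩, by rw [planCost_eq]⟩
  · rw [sum_count_length]; omega
  · intro ω _ L hL hpos
    have hmem : ω ∈ π := hcomply.subset (List.count_pos_iff.mp hpos)
    obtain ⟨a, b, rfl⟩ := List.append_of_mem hmem
    obtain ⟨o, hoL, hoa⟩ := hL a (prefix_isPlan preO postO ω b a s hplan.1)
    have h1 : 1 ≤ (a ++ ω :: b).count o :=
      List.count_pos_iff.mpr (List.mem_append_left _ hoa)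
    exact h1.trans (Finset.single_le_sum (f := fun o => (a ++ ω :: b).count o)
      (fun _ _ => Nat.zero_le _) hoL)

/-- inequality chain of Theorem 3: under the hypotheses of Theorem 3,
h^IP_Ω(s) ≤ h^{LMC_Ω}(s) ≤ cost(π), and in particular
h^IP_Ω(s) ≤ h^{LMC_Ω}(s) ≤ h*_Ω(s), the minimum cost of a plan complying with the
non-noisy observations Ω'. -/
theorem lmc_inequality_chain {Op V D : Type} [Fintype Op] [DecidableEq Op]
    (preO postO : Op → V → Option D) (s : V → D) (G : V → Option D)
    (π Ω Ω' : List Op) (cost : Op → ℕ) (υ : ℝ)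
    (hυ0 : 0 ≤ υ) (hυ1 : υ < 1)
    (hnoisy : NoisyFrom Ω Ω' π)
    (hbound : Ω.length ≤ Ω'.length + ⌊(Ω.length : ℝ) * υ⌋₊)
    (hplan : IsPlan preO postO s π G) (hcomply : Ω'.Sublist π)
    (C : (Op → ℕ) → Prop)
    (hC : ∀ π' : List Op, IsPlan preO postO s π' G → Ω'.Sublist π' →
      C (fun o => π'.count o)) :
    IPValue cost (fun Y => C Y ∧ ∃ YΩ : Op → ℕ, ObsConstraints Ω υ Y YΩ) ≤
      IPValue cost (fun Y => C Y ∧ ∃ YΩ : Op → ℕ,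
        ObsConstraints Ω υ Y YΩ ∧ LMCSat preO postO s Ω Y YΩ) ∧
    IPValue cost (fun Y => C Y ∧ ∃ YΩ : Op → ℕ,
        ObsConstraints Ω υ Y YΩ ∧ LMCSat preO postO s Ω Y YΩ) ≤
      ((PlanCost cost π : ℕ) : ℝ≥0∞) ∧
    IPValue cost (fun Y => C Y ∧ ∃ YΩ : Op → ℕ,
        ObsConstraints Ω υ Y YΩ ∧ LMCSat preO postO s Ω Y YΩ) ≤
      sInf {c : ℝ≥0∞ | ∃ π'' : List Op, IsPlan preO postO s π'' G ∧ Ω'.Sublist π'' ∧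
        c = ((PlanCost cost π'' : ℕ) : ℝ≥0∞)} := by
  refine ⟨?_, lmc_le_cost preO postO s G π Ω Ω' cost υ hnoisy.1 hbound hplan hcomply C
    (hC π hplan hcomply), ?_⟩
  · apply sInf_le_sInf
    rintro c ⟨Y, ⟨hY, YΩ, hO, _⟩, rfl⟩
    exact ⟨Y, ⟨hY, YΩ, hO⟩, rfl⟩
  · apply le_sInf
    rintro c ⟨π'', hp, hs, rfl⟩
    exact lmc_le_cost preO postO s G π'' Ω Ω' cost υ hnoisy.1 hbound hp hs C (hC π'' hp hs)
end

section
/- (Feasibility and safe filtering.) Let C be an operator-counting constraint set for the goal-recognition task at state s with goal condition G and observation sequence Ω. If there exists an s-plan for G complying with Ω, then the IP with constraints C and C_Ω (with υ = 0) has a feasible nonnegative integer assignment, and hence the satisfying IP heuristic value is finite. Equivalently, if the IP is infeasible — i.e., the satisfying IP heuristic value is ∞ — then no s-plan for G complies with Ω, so the goal hypothesis G can be safely filtered out. -/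
open scoped BigOperators ENNReal

/-- Feasibility and safe filtering: if C is an operator-counting
constraint set for the goal-recognition task at s and there exists an s-plan for G
complying with Ω, then the IP with constraints C and C_Ω (υ = 0) has a feasible
nonnegative integer assignment, and the satisfying IP heuristic value is finite.
Equivalently, if the IP heuristic value is infinite, no s-plan for G complies with Ω. -/
theorem ipValue_finite_of_complying_plan {Op V D : Type} [Fintype Op] [DecidableEq Op]
    (preO postO : Op → V → Option D) (s : V → D) (G : V → Option D)
    (Ω : List Op) (cost : Op → ℕ) (C : (Op → ℕ) → Prop)
    (hC : ∀ π : List Op, IsPlan preO postO s π G → Ω.Sublist π →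
      C (fun o => π.count o))
    (hex : ∃ π : List Op, IsPlan preO postO s π G ∧ Ω.Sublist π) :
    (∃ Y YΩ : Op → ℕ, C Y ∧ ObsConstraints Ω 0 Y YΩ) ∧
    IPValue cost (fun Y => C Y ∧ ∃ YΩ : Op → ℕ, ObsConstraints Ω 0 Y YΩ) ≠ ⊤ := by
  obtain ⟨π, hπ, hsub⟩ := hex
  have hobs : ObsConstraints Ω 0 (fun o => π.count o) (fun o => Ω.count o) := by
    refine ⟨fun o => le_rfl, fun o => hsub.count_le o, ?_⟩
    have h : ∑ o, Ω.count o = Ω.length := by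
      simpa using Multiset.sum_count_eq_card (s := Finset.univ) (m := (Ω : Multiset Op))
        (fun a _ => Finset.mem_univ a)
    rw [h]
    exact Nat.sub_le _ _
  refine ⟨⟨_, _, hC π hπ hsub, hobs⟩, ?_⟩
  refine ne_top_of_le_ne_top (ENNReal.natCast_ne_top (∑ o, cost o * π.count o)) ?_
  exact sInf_le ⟨_, ⟨hC π hπ hsub, _, hobs⟩, rfl⟩
end

section
/- (Soundness of the implemented landmark constraint.) Let υ ∈ [0,1), let Ω be obtained from a sequence Ω' by inserting entries that are each an operator not occurring in the plan π, and let π be an s-plan for goal condition G complying with Ω'. Fix an entry ω of Ω with occ_Ω(ω) > 0 and a disjunctive action landmark L for state s and goal condition pre(ω). Then the assignment Y_o := occ_π(o) for all o ∈ O, Y^Ω_ω := occ_Ω(ω) if ω occurs in π and Y^Ω_ω := 0 otherwise, satisfies the implemented linear landmark constraint Σ_{o∈L} Y_o − Y^Ω_ω / occ_Ω(ω) ≥ 0. -/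
open scoped BigOperators ENNReal

theorem seqApplicable_prefix {Op V D : Type} (preO postO : Op → V → Option D) (ω : Op)
    (l₁ l₂ : List Op) : ∀ s : V → D, SeqApplicable preO postO s (l₁ ++ ω :: l₂) →
      IsPlan preO postO s l₁ (preO ω) := by
  induction l₁ with
  | nil => intro s h; exact ⟨trivial, h.1⟩
  | cons a l ih =>
    intro s h
    have h2 := ih _ h.2
    exact ⟨⟨h.1, h2.1⟩, h2.2⟩

/-- soundness of the implemented landmark constraint: under the
noisy-observation hypotheses, for an entry ω of Ω with occ_Ω(ω) > 0 and a disjunctive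
action landmark L for state s and goal condition pre(ω), the assignment
Y_o := occ_π(o), Y^Ω_ω := occ_Ω(ω) if ω occurs in π and 0 otherwise, satisfies the
implemented linear landmark constraint Σ_{o ∈ L} Y_o - Y^Ω_ω / occ_Ω(ω) ≥ 0. -/
theorem implemented_landmark_constraint_sound {Op V D : Type} [DecidableEq Op]
    (preO postO : Op → V → Option D) (s : V → D) (G : V → Option D)
    (π Ω Ω' : List Op) (υ : ℝ) (hυ0 : 0 ≤ υ) (hυ1 : υ < 1)
    (hnoisy : NoisyFrom Ω Ω' π)
    (hplan : IsPlan preO postO s π G) (hcomply : Ω'.Sublist π)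
    (ω : Op) (hω : ω ∈ Ω) (hcount : 0 < Ω.count ω)
    (L : Finset Op)
    (hL : ∀ π' : List Op, IsPlan preO postO s π' (preO ω) → ∃ o ∈ L, o ∈ π') :
    0 ≤ (∑ o ∈ L, (π.count o : ℝ)) -
      (if ω ∈ π then (Ω.count ω : ℝ) else 0) / (Ω.count ω : ℝ) := by
  have hc : (Ω.count ω : ℝ) ≠ 0 := by exact_mod_cast hcount.ne'
  by_cases h : ω ∈ π
  · rw [if_pos h, div_self hc, sub_nonneg]
    obtain ⟨l₁, l₂, rfl⟩ := List.append_of_mem h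
    obtain ⟨o, hoL, ho⟩ := hL l₁ (seqApplicable_prefix preO postO ω l₁ l₂ s hplan.1)
    have h1 : (1 : ℝ) ≤ ((l₁ ++ ω :: l₂).count o : ℝ) := by
      exact_mod_cast List.count_pos_iff.2 (List.mem_append_left _ ho)
    exact h1.trans (Finset.single_le_sum
      (f := fun o => ((l₁ ++ ω :: l₂).count o : ℝ)) (fun _ _ => Nat.cast_nonneg _) hoL)
  · rw [if_neg h, zero_div, sub_zero]
    exact Finset.sum_nonneg fun _ _ => Nat.cast_nonneg _
end
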